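/- Consider an L-layer transformer with H heads per layer whose activation σ is L_lip-Lipschitz and all of whose weight matrices have Frobenius norm at most B, an arbitrary lazy layer set 𝓘 ⊆ {1,…,L}, and discard sets 𝓜_i ⊆ {1,…,i}. For i ∈ {1,…,L}, let e_X^{(i)} = ‖X^{(i)} − X̃^{(i)}‖_{2,∞} denote the ℓ_{2,∞} error between the hidden states of the original transformer and of the LightTransfer network, with e_X^{(0)} = 0, and for l ∈ 𝓘 let s_l = max_{i∈[N]} (1/H) Σ_{h=1}^H Σ_{j∈𝓜_i} [A_h^{(l)}]_{ij}, where A_h^{(l)} is the causal attention matrix of head h at layer l computed on LN(X^{(l−1)}). Then for every i ∈ {1,…,L}: e_X^{(i)} ≤ e_X^{(i−1)} + (H·B + L_lip·B² + 4·H·B³)·min{2, (1 + H·B·(1 + 4B²))·e_X^{(i−1)}} + 2·H·(B + L_lip·B³)·𝟙{i ∈ 𝓘}·s_i. -/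

import Mathlib

open scoped BigOperators
open Matrix

/-- The Euclidean (ℓ²) norm on `ℝ^d`. -/
noncomputable def l2norm {d : ℕ} (x : Fin d → ℝ) : ℝ := Real.sqrt (∑ i, x i ^ 2)

/-- The ℓ_{2,∞} norm of a matrix: the maximum ℓ² norm of its rows. -/
noncomputable def norm2inf {N d : ℕ} (X : Matrix (Fin N) (Fin d) ℝ) : ℝ :=
  ⨆ i, l2norm (X i)

/-- The Frobenius norm of a matrix. -/
noncomputable def frobNorm {m n : ℕ} (A : Matrix (Fin m) (Fin n) ℝ) : ℝ :=
  Real.sqrt (∑ i, ∑ j, A i j ^ 2)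

/-- The normalization map: `LN x = x` if `‖x‖₂ ≤ 1` and `LN x = x / ‖x‖₂` otherwise. -/
noncomputable def LN {d : ℕ} (x : Fin d → ℝ) : Fin d → ℝ :=
  if l2norm x ≤ 1 then x else (l2norm x)⁻¹ • x

/-- Row-wise application of `LN` to a matrix. -/
noncomputable def matLN {N d : ℕ} (X : Matrix (Fin N) (Fin d) ℝ) :
    Matrix (Fin N) (Fin d) ℝ :=
  Matrix.of fun i => LN (X i)

/-- The causal attention matrix of a single head. -/
noncomputable def causalAttn {N d dk : ℕ} (X : Matrix (Fin N) (Fin d) ℝ)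
    (WQ WK : Matrix (Fin d) (Fin dk) ℝ) : Matrix (Fin N) (Fin N) ℝ :=
  Matrix.of fun i j =>
    if j ≤ i then
      Real.exp ((X * WQ * (X * WK)ᵀ) i j) /
        ∑ k ∈ Finset.univ.filter (fun k : Fin N => k ≤ i),
          Real.exp ((X * WQ * (X * WK)ᵀ) i k)
    else 0

/-- Causal multi-head attention: `mha(X) = ∑_h A_h X W_{V,h}`. -/
noncomputable def mha {N d dk H : ℕ} (X : Matrix (Fin N) (Fin d) ℝ)
    (WQ WK : Fin H → Matrix (Fin d) (Fin dk) ℝ)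
    (WV : Fin H → Matrix (Fin d) (Fin d) ℝ) : Matrix (Fin N) (Fin d) ℝ :=
  ∑ h, causalAttn X (WQ h) (WK h) * X * WV h

/-- The lazy-masked attention matrix of a single head, given discard sets `M i ⊆ {0,…,i}`:
attention of row `i` is restricted to indices `j ≤ i` with `j ∉ M i` and renormalized. -/
noncomputable def lazyAttn {N d dk : ℕ} (X : Matrix (Fin N) (Fin d) ℝ)
    (WQ WK : Matrix (Fin d) (Fin dk) ℝ) (M : Fin N → Finset (Fin N)) :
    Matrix (Fin N) (Fin N) ℝ :=
  Matrix.of fun i j =>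
    if j ≤ i ∧ j ∉ M i then
      Real.exp ((X * WQ * (X * WK)ᵀ) i j) /
        ∑ k ∈ Finset.univ.filter (fun k : Fin N => k ≤ i ∧ k ∉ M i),
          Real.exp ((X * WQ * (X * WK)ᵀ) i k)
    else 0

/-- Lazy-masked causal multi-head attention. -/
noncomputable def lazyMha {N d dk H : ℕ} (X : Matrix (Fin N) (Fin d) ℝ)
    (WQ WK : Fin H → Matrix (Fin d) (Fin dk) ℝ)
    (WV : Fin H → Matrix (Fin d) (Fin d) ℝ) (M : Fin N → Finset (Fin N)) :
    Matrix (Fin N) (Fin d) ℝ :=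
  ∑ h, lazyAttn X (WQ h) (WK h) M * X * WV h

/-- The feed-forward module `ffn(X) = σ(X W₁) W₂`, with `σ` applied entrywise. -/
noncomputable def ffn {N d : ℕ} (σ : ℝ → ℝ) (X : Matrix (Fin N) (Fin d) ℝ)
    (W₁ W₂ : Matrix (Fin d) (Fin d) ℝ) : Matrix (Fin N) (Fin d) ℝ :=
  (X * W₁).map σ * W₂

/-- Hidden states of the original pre-norm transformer: `X⁽⁰⁾ = X` and
`Y⁽ⁱ⁾ = X⁽ⁱ⁻¹⁾ + mha⁽ⁱ⁾(LN(X⁽ⁱ⁻¹⁾))`, `X⁽ⁱ⁾ = Y⁽ⁱ⁾ + ffn⁽ⁱ⁾(LN(Y⁽ⁱ⁾))`,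
where layer `i` uses the weights with index `i`. -/
noncomputable def hiddenStates {N d dk H : ℕ} (σ : ℝ → ℝ)
    (WQ WK : ℕ → Fin H → Matrix (Fin d) (Fin dk) ℝ)
    (WV : ℕ → Fin H → Matrix (Fin d) (Fin d) ℝ)
    (WA1 WA2 : ℕ → Matrix (Fin d) (Fin d) ℝ)
    (X : Matrix (Fin N) (Fin d) ℝ) : ℕ → Matrix (Fin N) (Fin d) ℝ
  | 0 => X
  | i + 1 =>
    let Xp := hiddenStates σ WQ WK WV WA1 WA2 X i
    let Y := Xp + mha (matLN Xp) (WQ (i + 1)) (WK (i + 1)) (WV (i + 1))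
    Y + ffn σ (matLN Y) (WA1 (i + 1)) (WA2 (i + 1))

/-- Hidden states of the LightTransfer network with lazy-layer set `I` and discard sets `M`:
layers in `I` use the lazy-masked attention `mha~` instead of `mha`. -/
noncomputable def ltHiddenStates {N d dk H : ℕ} (σ : ℝ → ℝ)
    (WQ WK : ℕ → Fin H → Matrix (Fin d) (Fin dk) ℝ)
    (WV : ℕ → Fin H → Matrix (Fin d) (Fin d) ℝ)
    (WA1 WA2 : ℕ → Matrix (Fin d) (Fin d) ℝ)
    (I : Finset ℕ) (M : Fin N → Finset (Fin N))
    (X : Matrix (Fin N) (Fin d) ℝ) : ℕ → Matrix (Fin N) (Fin d) ℝ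
  | 0 => X
  | i + 1 =>
    let Xp := ltHiddenStates σ WQ WK WV WA1 WA2 I M X i
    let Y := Xp +
      (if i + 1 ∈ I then lazyMha (matLN Xp) (WQ (i + 1)) (WK (i + 1)) (WV (i + 1)) M
       else mha (matLN Xp) (WQ (i + 1)) (WK (i + 1)) (WV (i + 1)))
    Y + ffn σ (matLN Y) (WA1 (i + 1)) (WA2 (i + 1))

/-! ### The Euclidean norm on tuples -/

lemma l2norm_eq_norm {d : ℕ} (x : Fin d → ℝ) : l2norm x = ‖WithLp.toLp 2 x‖ := by
  simp [l2norm, EuclideanSpace.norm_eq]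

lemma l2norm_nonneg {d : ℕ} (x : Fin d → ℝ) : 0 ≤ l2norm x := Real.sqrt_nonneg _

lemma l2norm_add_le {d : ℕ} (x y : Fin d → ℝ) : l2norm (x + y) ≤ l2norm x + l2norm y := by
  simpa only [l2norm_eq_norm, WithLp.toLp_add] using norm_add_le _ _

lemma l2norm_sub_le {d : ℕ} (x y : Fin d → ℝ) : l2norm (x - y) ≤ l2norm x + l2norm y := by
  simpa only [l2norm_eq_norm, WithLp.toLp_sub] using norm_sub_le _ _

lemma l2norm_smul {d : ℕ} (c : ℝ) (x : Fin d → ℝ) : l2norm (c • x) = |c| * l2norm x := by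
  simp only [l2norm_eq_norm, WithLp.toLp_smul, norm_smul, Real.norm_eq_abs]

lemma l2norm_sum_le {ι : Type*} {d : ℕ} (s : Finset ι) (f : ι → Fin d → ℝ) :
    l2norm (∑ i ∈ s, f i) ≤ ∑ i ∈ s, l2norm (f i) := by
  simpa only [l2norm_eq_norm, WithLp.toLp_sum] using norm_sum_le s _

lemma abs_dotProduct_le {d : ℕ} (x y : Fin d → ℝ) : |x ⬝ᵥ y| ≤ l2norm x * l2norm y := by
  rw [l2norm, l2norm, ← Real.sqrt_mul (Finset.sum_nonneg fun _ _ => sq_nonneg _)]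
  exact Real.abs_le_sqrt (Finset.sum_mul_sq_le_sq_mul_sq _ _ _)

lemma l2norm_vecMul_le {m n : ℕ} (x : Fin m → ℝ) (W : Matrix (Fin m) (Fin n) ℝ) :
    l2norm (x ᵥ* W) ≤ l2norm x * frobNorm W := by
  rw [l2norm, l2norm, frobNorm, ← Real.sqrt_mul (Finset.sum_nonneg fun _ _ => sq_nonneg _)]
  apply Real.sqrt_le_sqrt
  rw [Finset.sum_comm (f := fun i j => W i j ^ 2), Finset.mul_sum]
  exact Finset.sum_le_sum fun j _ => Finset.sum_mul_sq_le_sq_mul_sq Finset.univ x fun i => W i j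

lemma l2norm_vecMul_le_of_frobNorm_le {m n : ℕ} {B δ : ℝ} {x : Fin m → ℝ}
    {W : Matrix (Fin m) (Fin n) ℝ} (hx : l2norm x ≤ δ) (hW : frobNorm W ≤ B) :
    l2norm (x ᵥ* W) ≤ δ * B :=
  (l2norm_vecMul_le x W).trans
    (mul_le_mul hx hW (Real.sqrt_nonneg _) ((l2norm_nonneg x).trans hx))

lemma l2norm_le_mul_of_abs_le {d : ℕ} {c : ℝ} (hc : 0 ≤ c) {x y : Fin d → ℝ}
    (h : ∀ i, |x i| ≤ c * |y i|) : l2norm x ≤ c * l2norm y := by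
  have hsmul := l2norm_smul c y
  rw [abs_of_nonneg hc] at hsmul
  rw [← hsmul]
  refine Real.sqrt_le_sqrt (Finset.sum_le_sum fun i _ => sq_le_sq.2 ?_)
  simpa [abs_mul, abs_of_nonneg hc] using h i

lemma l2norm_row_le_norm2inf {N d : ℕ} (X : Matrix (Fin N) (Fin d) ℝ) (i : Fin N) :
    l2norm (X i) ≤ norm2inf X :=
  le_ciSup (f := fun i => l2norm (X i)) (Set.finite_range _).bddAbove i

lemma norm2inf_nonneg {N d : ℕ} (X : Matrix (Fin N) (Fin d) ℝ) : 0 ≤ norm2inf X :=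
  Real.iSup_nonneg fun _ => l2norm_nonneg _

/-! ### Normalization -/

lemma l2norm_LN_le_one {d : ℕ} (x : Fin d → ℝ) : l2norm (LN x) ≤ 1 := by
  unfold LN
  split_ifs with h
  · exact h
  · have : 0 < l2norm x := by linarith
    rw [l2norm_smul, abs_of_pos (inv_pos.2 this), inv_mul_cancel₀ this.ne']

/-- The variational inequality for `LN` as the projection onto the unit ball. -/
lemma dotProduct_sub_LN_nonpos {d : ℕ} (x q : Fin d → ℝ) (hq : l2norm q ≤ 1) :
    (x - LN x) ⬝ᵥ (q - LN x) ≤ 0 := by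
  unfold LN
  split_ifs with h
  · simp
  · have hpos : 0 < l2norm x := by linarith
    have hxx : x ⬝ᵥ x = l2norm x ^ 2 := by
      rw [l2norm, Real.sq_sqrt (Finset.sum_nonneg fun _ _ => sq_nonneg _)]
      simp [dotProduct, sq]
    have hxq : x ⬝ᵥ q ≤ l2norm x :=
      (le_abs_self _).trans ((abs_dotProduct_le x q).trans
        (mul_le_of_le_one_right hpos.le hq))
    have hfac : x - (l2norm x)⁻¹ • x = (1 - (l2norm x)⁻¹) • x := by
      rw [sub_smul, one_smul]
    rw [hfac, smul_dotProduct, dotProduct_sub, dotProduct_smul, hxx, smul_eq_mul, smul_eq_mul]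
    have h1 : (l2norm x)⁻¹ * l2norm x ^ 2 = l2norm x := by field_simp
    rw [h1]
    have h2 : (l2norm x)⁻¹ ≤ 1 := inv_le_one_of_one_le₀ (by linarith)
    exact mul_nonpos_of_nonneg_of_nonpos (by linarith) (by linarith)

lemma l2norm_LN_sub_LN_le {d : ℕ} (x y : Fin d → ℝ) :
    l2norm (LN x - LN y) ≤ l2norm (x - y) := by
  have h1 := dotProduct_sub_LN_nonpos x (LN y) (l2norm_LN_le_one y)
  have h2 := dotProduct_sub_LN_nonpos y (LN x) (l2norm_LN_le_one x)
  have h3 := (le_abs_self _).trans (abs_dotProduct_le (x - y) (LN x - LN y))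
  have h4 : (LN x - LN y) ⬝ᵥ (LN x - LN y) = l2norm (LN x - LN y) ^ 2 := by
    rw [l2norm, Real.sq_sqrt (Finset.sum_nonneg fun _ _ => sq_nonneg _)]
    simp [dotProduct, sq]
  simp only [dotProduct_sub, sub_dotProduct] at h1 h2 h3 h4
  have h5 : l2norm (LN x - LN y) ^ 2 ≤ l2norm (x - y) * l2norm (LN x - LN y) := by
    linarith [dotProduct_comm (LN x) (LN y)]
  by_contra! hlt
  nlinarith [l2norm_nonneg (x - y)]

lemma l2norm_LN_sub_LN_le_min {d : ℕ} (x y : Fin d → ℝ) :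
    l2norm (LN x - LN y) ≤ min 2 (l2norm (x - y)) :=
  le_min (by linarith [l2norm_sub_le (LN x) (LN y), l2norm_LN_le_one x, l2norm_LN_le_one y])
    (l2norm_LN_sub_LN_le x y)

lemma l2norm_matLN_row_le_one {N d : ℕ} (X : Matrix (Fin N) (Fin d) ℝ) (i : Fin N) :
    l2norm (matLN X i) ≤ 1 :=
  l2norm_LN_le_one (X i)

/-! ### Softmax over a finite set of indices -/

/-- The softmax of `x` over the indices in `S`, extended by zero outside `S`. -/
noncomputable def softmaxOn {ι : Type*} [DecidableEq ι] (S : Finset ι) (x : ι → ℝ) (j : ι) : ℝ :=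
  if j ∈ S then Real.exp (x j) / ∑ k ∈ S, Real.exp (x k) else 0

section Softmax

variable {ι : Type*} [DecidableEq ι]

lemma softmaxOn_nonneg (S : Finset ι) (x : ι → ℝ) (j : ι) : 0 ≤ softmaxOn S x j := by
  unfold softmaxOn
  split_ifs <;> positivity

lemma sum_softmaxOn [Fintype ι] {S : Finset ι} (hS : S.Nonempty) (x : ι → ℝ) :
    ∑ j, softmaxOn S x j = 1 := by
  have : 0 < ∑ k ∈ S, Real.exp (x k) := Finset.sum_pos (fun _ _ => Real.exp_pos _) hS
  simp only [softmaxOn, Finset.sum_ite_mem, Finset.univ_inter]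
  rw [← Finset.sum_div, div_self this.ne']

lemma sum_softmaxOn_le_one [Fintype ι] (S : Finset ι) (x : ι → ℝ) :
    ∑ j, softmaxOn S x j ≤ 1 := by
  rcases S.eq_empty_or_nonempty with rfl | hS
  · simp [softmaxOn]
  · exact (sum_softmaxOn hS x).le

lemma exp_sub_one_le_half_mul {t : ℝ} (ht : 0 ≤ t) :
    Real.exp t - 1 ≤ t / 2 * (Real.exp t + 1) := by
  have hderiv : ∀ u : ℝ, HasDerivAt (fun u => u / 2 * (Real.exp u + 1) - Real.exp u)
      (1 / 2 * (Real.exp u + 1) + u / 2 * Real.exp u - Real.exp u) u := fun u =>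
    (((hasDerivAt_id u).div_const 2).mul ((Real.hasDerivAt_exp u).add_const 1)).sub
      (Real.hasDerivAt_exp u)
  have hmono : MonotoneOn (fun u : ℝ => u / 2 * (Real.exp u + 1) - Real.exp u) (Set.Ici 0) := by
    refine monotoneOn_of_deriv_nonneg (convex_Ici 0)
      (fun u _ => (hderiv u).continuousAt.continuousWithinAt)
      (fun u _ => (hderiv u).differentiableAt.differentiableWithinAt) fun u _ => ?_
    rw [(hderiv u).deriv]
    have h1 := Real.add_one_le_exp (-u)
    have h2 : Real.exp (-u) * Real.exp u = 1 := by rw [← Real.exp_add]; simp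
    nlinarith [Real.exp_pos u]
  have := hmono (Set.mem_Ici.2 le_rfl) (Set.mem_Ici.2 ht) ht
  simp only [Real.exp_zero] at this
  linarith

lemma abs_exp_sub_exp_le (a b : ℝ) :
    |Real.exp a - Real.exp b| ≤ |a - b| / 2 * (Real.exp a + Real.exp b) := by
  wlog h : b ≤ a generalizing a b
  · rw [abs_sub_comm, abs_sub_comm a, add_comm (Real.exp a)]
    exact this b a (le_of_not_ge h)
  rw [abs_of_nonneg (sub_nonneg.2 (Real.exp_le_exp.2 h)), abs_of_nonneg (sub_nonneg.2 h)]
  have h1 := mul_le_mul_of_nonneg_left (exp_sub_one_le_half_mul (sub_nonneg.2 h))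
    (Real.exp_pos b).le
  have h2 : Real.exp b * Real.exp (a - b) = Real.exp a := by rw [← Real.exp_add]; simp
  linear_combination h1 + ((a - b) / 2 - 1) * h2

lemma abs_softmaxOn_mul_sub_le {S : Finset ι} {x y : ι → ℝ} {ε : ℝ}
    (h : ∀ j ∈ S, |x j - y j| ≤ ε) (j k : ι) :
    |softmaxOn S x j * softmaxOn S y k - softmaxOn S y j * softmaxOn S x k| ≤
      ε * (softmaxOn S x j * softmaxOn S y k + softmaxOn S y j * softmaxOn S x k) := by
  unfold softmaxOn
  by_cases hj : j ∈ S
  swap; · simp [hj]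
  by_cases hk : k ∈ S
  swap; · simp [hk]
  simp only [hj, hk, if_true]
  set P := ∑ k ∈ S, Real.exp (x k)
  set Q := ∑ k ∈ S, Real.exp (y k)
  have hP : 0 ≤ P := Finset.sum_nonneg fun _ _ => (Real.exp_pos _).le
  have hQ : 0 ≤ Q := Finset.sum_nonneg fun _ _ => (Real.exp_pos _).le
  have e1 : Real.exp (x j) / P * (Real.exp (y k) / Q) = Real.exp (x j + y k) / (P * Q) := by
    rw [div_mul_div_comm, Real.exp_add]
  have e2 : Real.exp (y j) / Q * (Real.exp (x k) / P) = Real.exp (y j + x k) / (P * Q) := by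
    rw [div_mul_div_comm, Real.exp_add, mul_comm Q P]
  rw [e1, e2, ← sub_div, ← add_div, abs_div, abs_of_nonneg (mul_nonneg hP hQ), ← mul_div_assoc]
  refine div_le_div_of_nonneg_right ?_ (mul_nonneg hP hQ)
  refine (abs_exp_sub_exp_le _ _).trans (mul_le_mul_of_nonneg_right ?_ (by positivity))
  have h1 := abs_le.1 (h j hj)
  have h2 := abs_le.1 (h k hk)
  have : |x j + y k - (y j + x k)| ≤ 2 * ε := abs_le.2 ⟨by linarith, by linarith⟩
  linarith

/-- Softmax is `2`-Lipschitz from `ℓ_∞` to `ℓ_1`. -/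
lemma sum_abs_softmaxOn_sub_le [Fintype ι] {S : Finset ι} {x y : ι → ℝ} {ε : ℝ} (hε : 0 ≤ ε)
    (h : ∀ j ∈ S, |x j - y j| ≤ ε) :
    ∑ j, |softmaxOn S x j - softmaxOn S y j| ≤ 2 * ε := by
  rcases S.eq_empty_or_nonempty with rfl | hS
  · simpa [softmaxOn] using hε
  have hx := sum_softmaxOn hS x
  have hy := sum_softmaxOn hS y
  calc ∑ j, |softmaxOn S x j - softmaxOn S y j|
      = ∑ j, |∑ k, (softmaxOn S x j * softmaxOn S y k -
          softmaxOn S y j * softmaxOn S x k)| := by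
        simp only [Finset.sum_sub_distrib, ← Finset.mul_sum, hx, hy, mul_one]
    _ ≤ ∑ j, ∑ k, ε * (softmaxOn S x j * softmaxOn S y k +
          softmaxOn S y j * softmaxOn S x k) :=
        Finset.sum_le_sum fun j _ => (Finset.abs_sum_le_sum_abs _ _).trans
          (Finset.sum_le_sum fun k _ => abs_softmaxOn_mul_sub_le h j k)
    _ = 2 * ε := by
        simp only [← Finset.mul_sum, Finset.sum_add_distrib, hx, hy, mul_one]
        ring

/-- Discarding a set of indices moves the softmax by twice the discarded mass in `ℓ_1`. -/
lemma sum_abs_softmaxOn_sub_sdiff_le [Fintype ι] {S T : Finset ι} (hS : S.Nonempty)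
    (x : ι → ℝ) :
    ∑ j, |softmaxOn S x j - softmaxOn (S \ T) x j| ≤ 2 * ∑ j ∈ T, softmaxOn S x j := by
  have key : ∀ j, |softmaxOn S x j - softmaxOn (S \ T) x j| =
      softmaxOn (S \ T) x j - softmaxOn S x j + 2 * if j ∈ T then softmaxOn S x j else 0 := by
    intro j
    by_cases hjT : j ∈ T
    · have : softmaxOn (S \ T) x j = 0 := by simp [softmaxOn, hjT]
      rw [this, sub_zero, abs_of_nonneg (softmaxOn_nonneg S x j), if_pos hjT]
      ring
    · rw [if_neg hjT, mul_zero, add_zero, abs_sub_comm, abs_of_nonneg]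
      by_cases hjS : j ∈ S
      · have hmem : j ∈ S \ T := Finset.mem_sdiff.2 ⟨hjS, hjT⟩
        simp only [softmaxOn, hjS, hmem, if_true]
        refine sub_nonneg.2 (div_le_div_of_nonneg_left (Real.exp_pos _).le
          (Finset.sum_pos (fun _ _ => Real.exp_pos _) ⟨j, hmem⟩) ?_)
        exact Finset.sum_le_sum_of_subset_of_nonneg Finset.sdiff_subset
          fun _ _ _ => (Real.exp_pos _).le
      · simp [softmaxOn, hjS]
  simp only [key, Finset.sum_add_distrib, Finset.sum_sub_distrib, ← Finset.mul_sum,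
    Finset.sum_ite_mem, Finset.univ_inter, sum_softmaxOn hS x]
  linarith [sum_softmaxOn_le_one (S \ T) x]

end Softmax

/-! ### Attention -/

lemma causalAttn_eq_softmaxOn {N d dk : ℕ} (X : Matrix (Fin N) (Fin d) ℝ)
    (WQ WK : Matrix (Fin d) (Fin dk) ℝ) (i j : Fin N) :
    causalAttn X WQ WK i j =
      softmaxOn (Finset.univ.filter fun k => k ≤ i) ((X * WQ * (X * WK)ᵀ) i) j := by
  simp [causalAttn, softmaxOn]

lemma lazyAttn_eq_softmaxOn {N d dk : ℕ} (X : Matrix (Fin N) (Fin d) ℝ)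
    (WQ WK : Matrix (Fin d) (Fin dk) ℝ) (M : Fin N → Finset (Fin N)) (i j : Fin N) :
    lazyAttn X WQ WK M i j =
      softmaxOn ((Finset.univ.filter fun k => k ≤ i) \ M i) ((X * WQ * (X * WK)ᵀ) i) j := by
  have : (Finset.univ.filter fun k => k ≤ i) \ M i =
      Finset.univ.filter fun k => k ≤ i ∧ k ∉ M i := by
    ext k; simp
  rw [this]
  simp [lazyAttn, softmaxOn]

lemma abs_logit_sub_le {N d dk : ℕ} {B δ : ℝ} {Z Z' : Matrix (Fin N) (Fin d) ℝ}
    {WQ WK : Matrix (Fin d) (Fin dk) ℝ} (hQ : frobNorm WQ ≤ B) (hK : frobNorm WK ≤ B)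
    (hZ : ∀ i, l2norm (Z i) ≤ 1) (hZ' : ∀ i, l2norm (Z' i) ≤ 1)
    (hδ : ∀ i, l2norm (Z i - Z' i) ≤ δ) (i j : Fin N) :
    |(Z * WQ * (Z * WK)ᵀ) i j - (Z' * WQ * (Z' * WK)ᵀ) i j| ≤ 2 * B ^ 2 * δ := by
  have hB : 0 ≤ B := (Real.sqrt_nonneg _).trans hQ
  have hδ0 : 0 ≤ δ := (l2norm_nonneg _).trans (hδ i)
  have hlogit : ∀ Z : Matrix (Fin N) (Fin d) ℝ,
      (Z * WQ * (Z * WK)ᵀ) i j = (Z i ᵥ* WQ) ⬝ᵥ (Z j ᵥ* WK) := fun _ => rfl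
  have hsplit : (Z i ᵥ* WQ) ⬝ᵥ (Z j ᵥ* WK) - (Z' i ᵥ* WQ) ⬝ᵥ (Z' j ᵥ* WK) =
      ((Z i - Z' i) ᵥ* WQ) ⬝ᵥ (Z j ᵥ* WK) + (Z' i ᵥ* WQ) ⬝ᵥ ((Z j - Z' j) ᵥ* WK) := by
    simp only [sub_vecMul, sub_dotProduct, dotProduct_sub]
    ring
  rw [hlogit, hlogit, hsplit]
  have h1 := (abs_dotProduct_le ((Z i - Z' i) ᵥ* WQ) (Z j ᵥ* WK)).trans
    (mul_le_mul (l2norm_vecMul_le_of_frobNorm_le (hδ i) hQ)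
      (l2norm_vecMul_le_of_frobNorm_le (hZ j) hK) (l2norm_nonneg _) (by positivity))
  have h2 := (abs_dotProduct_le (Z' i ᵥ* WQ) ((Z j - Z' j) ᵥ* WK)).trans
    (mul_le_mul (l2norm_vecMul_le_of_frobNorm_le (hZ' i) hQ)
      (l2norm_vecMul_le_of_frobNorm_le (hδ j) hK) (l2norm_nonneg _) (by positivity))
  refine (abs_add_le _ _).trans ((add_le_add h1 h2).trans (le_of_eq ?_))
  ring

lemma l2norm_weighted_sum_sub_le {N d : ℕ} {δ : ℝ} {Z Z' : Fin N → Fin d → ℝ} {a b : Fin N → ℝ}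
    (ha : ∀ j, 0 ≤ a j) (ha1 : ∑ j, a j ≤ 1) (hδ0 : 0 ≤ δ)
    (hZ' : ∀ j, l2norm (Z' j) ≤ 1) (hδ : ∀ j, l2norm (Z j - Z' j) ≤ δ) :
    l2norm (∑ j, a j • Z j - ∑ j, b j • Z' j) ≤ δ + ∑ j, |a j - b j| := by
  have hsplit : ∑ j, a j • Z j - ∑ j, b j • Z' j =
      ∑ j, (a j • (Z j - Z' j) + (a j - b j) • Z' j) := by
    rw [← Finset.sum_sub_distrib]
    exact Finset.sum_congr rfl fun j _ => by module
  rw [hsplit]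
  calc _ ≤ ∑ j, l2norm (a j • (Z j - Z' j) + (a j - b j) • Z' j) := l2norm_sum_le _ _
    _ ≤ ∑ j, (a j * δ + |a j - b j|) := by
        refine Finset.sum_le_sum fun j _ => (l2norm_add_le _ _).trans ?_
        rw [l2norm_smul, l2norm_smul, abs_of_nonneg (ha j)]
        exact add_le_add (mul_le_mul_of_nonneg_left (hδ j) (ha j))
          (mul_le_of_le_one_right (abs_nonneg _) (hZ' j))
    _ ≤ δ + ∑ j, |a j - b j| := by
        rw [Finset.sum_add_distrib, ← Finset.sum_mul]
        linarith [mul_le_mul_of_nonneg_right ha1 hδ0]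

lemma attn_mul_row {N d : ℕ} (A : Matrix (Fin N) (Fin N) ℝ) (Z : Matrix (Fin N) (Fin d) ℝ)
    (W : Matrix (Fin d) (Fin d) ℝ) (i : Fin N) :
    (A * Z * W) i = (∑ j, A i j • Z j) ᵥ* W := by
  have : (A * Z) i = ∑ j, A i j • Z j := by
    ext k; simp [Matrix.mul_apply]
  rw [← this]
  rfl

/-- Rowwise distance between the outputs of two attention heads. -/
lemma l2norm_attn_row_sub_le {N d : ℕ} {B δ c : ℝ} {A A' : Matrix (Fin N) (Fin N) ℝ}
    {Z Z' : Matrix (Fin N) (Fin d) ℝ} {W : Matrix (Fin d) (Fin d) ℝ} (hW : frobNorm W ≤ B)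
    (i : Fin N) (ha : ∀ j, 0 ≤ A i j) (ha1 : ∑ j, A i j ≤ 1)
    (hZ' : ∀ j, l2norm (Z' j) ≤ 1) (hδ : ∀ j, l2norm (Z j - Z' j) ≤ δ)
    (hc : ∑ j, |A i j - A' i j| ≤ c) :
    l2norm ((A * Z * W) i - (A' * Z' * W) i) ≤ (δ + c) * B := by
  rw [attn_mul_row, attn_mul_row, ← sub_vecMul]
  refine l2norm_vecMul_le_of_frobNorm_le ?_ hW
  exact (l2norm_weighted_sum_sub_le ha ha1 ((l2norm_nonneg _).trans (hδ i)) hZ' hδ).trans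
    (by linarith)

lemma l2norm_mha_row_sub_le {N d dk H : ℕ} {B δ : ℝ} {Z Z' : Matrix (Fin N) (Fin d) ℝ}
    {WQ WK : Fin H → Matrix (Fin d) (Fin dk) ℝ} {WV : Fin H → Matrix (Fin d) (Fin d) ℝ}
    (hQ : ∀ h, frobNorm (WQ h) ≤ B) (hK : ∀ h, frobNorm (WK h) ≤ B)
    (hV : ∀ h, frobNorm (WV h) ≤ B)
    (hZ : ∀ i, l2norm (Z i) ≤ 1) (hZ' : ∀ i, l2norm (Z' i) ≤ 1)
    (hδ : ∀ i, l2norm (Z i - Z' i) ≤ δ) (i : Fin N) :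
    l2norm (mha Z WQ WK WV i - mha Z' WQ WK WV i) ≤ H * B * (1 + 4 * B ^ 2) * δ := by
  have hδ0 : 0 ≤ δ := (l2norm_nonneg _).trans (hδ i)
  have hrow : mha Z WQ WK WV i - mha Z' WQ WK WV i =
      ∑ h, ((causalAttn Z (WQ h) (WK h) * Z * WV h) i -
        (causalAttn Z' (WQ h) (WK h) * Z' * WV h) i) := by
    rw [Finset.sum_sub_distrib]
    ext k; simp [mha, Matrix.sum_apply]
  rw [hrow]
  refine (l2norm_sum_le _ _).trans ?_
  calc _ ≤ ∑ _h : Fin H, (δ + 2 * (2 * B ^ 2 * δ)) * B := by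
        refine Finset.sum_le_sum fun h _ => l2norm_attn_row_sub_le (hV h) i
          (fun j => ?_) ?_ hZ' hδ ?_
        · rw [causalAttn_eq_softmaxOn]; exact softmaxOn_nonneg _ _ _
        · simp only [causalAttn_eq_softmaxOn]; exact sum_softmaxOn_le_one _ _
        · simp only [causalAttn_eq_softmaxOn]
          exact sum_abs_softmaxOn_sub_le (by positivity)
            fun j _ => abs_logit_sub_le (hQ h) (hK h) hZ hZ' hδ i j
    _ = _ := by
        rw [Finset.sum_const, Finset.card_univ, Fintype.card_fin, nsmul_eq_mul]
        ring

lemma l2norm_mha_row_sub_lazyMha_le {N d dk H : ℕ} {B δ : ℝ} {Z Z' : Matrix (Fin N) (Fin d) ℝ}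
    {WQ WK : Fin H → Matrix (Fin d) (Fin dk) ℝ} {WV : Fin H → Matrix (Fin d) (Fin d) ℝ}
    {M : Fin N → Finset (Fin N)}
    (hQ : ∀ h, frobNorm (WQ h) ≤ B) (hK : ∀ h, frobNorm (WK h) ≤ B)
    (hV : ∀ h, frobNorm (WV h) ≤ B)
    (hZ : ∀ i, l2norm (Z i) ≤ 1) (hZ' : ∀ i, l2norm (Z' i) ≤ 1)
    (hδ : ∀ i, l2norm (Z i - Z' i) ≤ δ) (i : Fin N) :
    l2norm (mha Z WQ WK WV i - lazyMha Z' WQ WK WV M i) ≤ H * B * (1 + 4 * B ^ 2) * δ +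
      2 * B * ∑ h, ∑ j ∈ M i, causalAttn Z (WQ h) (WK h) i j := by
  have hδ0 : 0 ≤ δ := (l2norm_nonneg _).trans (hδ i)
  have hrow : mha Z WQ WK WV i - lazyMha Z' WQ WK WV M i =
      ∑ h, ((causalAttn Z (WQ h) (WK h) * Z * WV h) i -
        (lazyAttn Z' (WQ h) (WK h) M * Z' * WV h) i) := by
    rw [Finset.sum_sub_distrib]
    ext k; simp [mha, lazyMha, Matrix.sum_apply]
  rw [hrow]
  refine (l2norm_sum_le _ _).trans ?_
  calc _ ≤ ∑ h : Fin H, (δ + (2 * ∑ j ∈ M i, causalAttn Z (WQ h) (WK h) i j +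
          2 * (2 * B ^ 2 * δ))) * B := by
        refine Finset.sum_le_sum fun h _ => l2norm_attn_row_sub_le (hV h) i
          (fun j => ?_) ?_ hZ' hδ ?_
        · rw [causalAttn_eq_softmaxOn]; exact softmaxOn_nonneg _ _ _
        · simp only [causalAttn_eq_softmaxOn]; exact sum_softmaxOn_le_one _ _
        · simp only [causalAttn_eq_softmaxOn, lazyAttn_eq_softmaxOn]
          have hmask := sum_abs_softmaxOn_sub_sdiff_le
            (S := Finset.univ.filter fun k => k ≤ i) (T := M i)
            ⟨i, by simp⟩ ((Z * WQ h * (Z * WK h)ᵀ) i)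
          have hlip := sum_abs_softmaxOn_sub_le
            (S := (Finset.univ.filter fun k => k ≤ i) \ M i) (ε := 2 * B ^ 2 * δ) (by positivity)
            fun j _ => abs_logit_sub_le (hQ h) (hK h) hZ hZ' hδ i j
          refine le_trans ?_ (add_le_add hmask hlip)
          rw [← Finset.sum_add_distrib]
          exact Finset.sum_le_sum fun j _ => abs_sub_le _ _ _
    _ = _ := by
        rw [← Finset.sum_mul, Finset.sum_add_distrib, Finset.sum_add_distrib, ← Finset.mul_sum]
        simp only [Finset.sum_const, Finset.card_univ, Fintype.card_fin, nsmul_eq_mul]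
        ring

/-! ### Feed-forward modules and layers -/

lemma l2norm_ffn_row_sub_le {N d : ℕ} {B K δ : ℝ} {σ : ℝ → ℝ} (hK : 0 ≤ K)
    (hσ : ∀ x y : ℝ, |σ x - σ y| ≤ K * |x - y|) {Z Z' : Matrix (Fin N) (Fin d) ℝ}
    {W₁ W₂ : Matrix (Fin d) (Fin d) ℝ} (hW₁ : frobNorm W₁ ≤ B) (hW₂ : frobNorm W₂ ≤ B)
    (i : Fin N) (hδ : l2norm (Z i - Z' i) ≤ δ) :
    l2norm (ffn σ Z W₁ W₂ i - ffn σ Z' W₁ W₂ i) ≤ K * B ^ 2 * δ := by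
  have hrow : ffn σ Z W₁ W₂ i - ffn σ Z' W₁ W₂ i =
      (((Z * W₁).map σ) i - ((Z' * W₁).map σ) i) ᵥ* W₂ := by
    rw [sub_vecMul]; rfl
  have hin : l2norm (((Z * W₁).map σ) i - ((Z' * W₁).map σ) i) ≤ K * (δ * B) := by
    refine (l2norm_le_mul_of_abs_le hK (y := (Z i - Z' i) ᵥ* W₁) fun k => ?_).trans
      (mul_le_mul_of_nonneg_left (l2norm_vecMul_le_of_frobNorm_le hδ hW₁) hK)
    rw [sub_vecMul]
    exact hσ _ _
  rw [hrow]
  exact (l2norm_vecMul_le_of_frobNorm_le hin hW₂).trans (le_of_eq (by ring))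

/-- Rowwise error propagation through one pre-norm layer whose attention outputs `P`, `P'` differ
by at most `c * min 2 e + r`. -/
lemma l2norm_layer_row_sub_le {N d : ℕ} {B K c e r : ℝ} {σ : ℝ → ℝ} (hK : 0 ≤ K)
    (hσ : ∀ x y : ℝ, |σ x - σ y| ≤ K * |x - y|) {X X' P P' : Matrix (Fin N) (Fin d) ℝ}
    {W₁ W₂ : Matrix (Fin d) (Fin d) ℝ} (hW₁ : frobNorm W₁ ≤ B) (hW₂ : frobNorm W₂ ≤ B)
    (hc : 0 ≤ c) (he : 0 ≤ e) (hr : 0 ≤ r) (i : Fin N) (hX : l2norm (X i - X' i) ≤ e)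
    (hP : l2norm (P i - P' i) ≤ c * min 2 e + r) :
    l2norm ((X + P + ffn σ (matLN (X + P)) W₁ W₂) i -
        (X' + P' + ffn σ (matLN (X' + P')) W₁ W₂) i) ≤
      e + (c + K * B ^ 2) * min 2 ((1 + c) * e) + (1 + K * B ^ 2) * r := by
  set m := min 2 ((1 + c) * e) with hm
  have hmin : min 2 e ≤ m := min_le_min le_rfl (by nlinarith)
  have hYsplit : (X + P) i - (X' + P') i = (X i - X' i) + (P i - P' i) := by
    ext k
    simp only [Pi.add_apply, Pi.sub_apply, Matrix.add_apply]
    ring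
  have hY : l2norm ((X + P) i - (X' + P') i) ≤ e + (c * min 2 e + r) := by
    rw [hYsplit]
    exact (l2norm_add_le _ _).trans (add_le_add hX hP)
  have hLN : l2norm (matLN (X + P) i - matLN (X' + P') i) ≤ m + r := by
    refine (l2norm_LN_sub_LN_le_min ((X + P) i) ((X' + P') i)).trans ?_
    rw [hm, ← min_add_add_right]
    refine min_le_min (by linarith) (hY.trans ?_)
    nlinarith [mul_le_mul_of_nonneg_left (min_le_right 2 e) hc]
  have hF := l2norm_ffn_row_sub_le hK hσ hW₁ hW₂ i hLN
  have hsplit : (X + P + ffn σ (matLN (X + P)) W₁ W₂) i -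
      (X' + P' + ffn σ (matLN (X' + P')) W₁ W₂) i = ((X + P) i - (X' + P') i) +
      (ffn σ (matLN (X + P)) W₁ W₂ i - ffn σ (matLN (X' + P')) W₁ W₂ i) := by
    ext k; simp; ring
  rw [hsplit]
  refine (l2norm_add_le _ _).trans ((add_le_add hY hF).trans ?_)
  linarith [mul_le_mul_of_nonneg_left hmin hc]

/-- Recursive error bound between the hidden states of the original transformer and the
LightTransfer network (Eqn. (recur) of Theorem 2):
`e⁽ⁱ⁾ ≤ e⁽ⁱ⁻¹⁾ + (HB + L_lip B² + 4HB³) min{2, (1 + HB(1+4B²)) e⁽ⁱ⁻¹⁾}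
       + 2H(B + L_lip B³) 𝟙{i ∈ 𝓘} sᵢ`. -/
theorem lighttransfer_hidden_error_recursion {L H N d dk : ℕ} (B L_lip : ℝ)
    (hB : 0 < B) (hL_lip : 0 < L_lip)
    (σ : ℝ → ℝ) (hσ : ∀ x y : ℝ, |σ x - σ y| ≤ L_lip * |x - y|)
    (WQ WK : ℕ → Fin H → Matrix (Fin d) (Fin dk) ℝ)
    (WV : ℕ → Fin H → Matrix (Fin d) (Fin d) ℝ)
    (WA1 WA2 : ℕ → Matrix (Fin d) (Fin d) ℝ)
    (hWQ : ∀ l, 1 ≤ l → l ≤ L → ∀ h, frobNorm (WQ l h) ≤ B)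
    (hWK : ∀ l, 1 ≤ l → l ≤ L → ∀ h, frobNorm (WK l h) ≤ B)
    (hWV : ∀ l, 1 ≤ l → l ≤ L → ∀ h, frobNorm (WV l h) ≤ B)
    (hWA1 : ∀ l, 1 ≤ l → l ≤ L → frobNorm (WA1 l) ≤ B)
    (hWA2 : ∀ l, 1 ≤ l → l ≤ L → frobNorm (WA2 l) ≤ B)
    (I : Finset ℕ) (hI : I ⊆ Finset.Icc 1 L)
    (M : Fin N → Finset (Fin N)) (hM : ∀ i : Fin N, ∀ j ∈ M i, j ≤ i)
    (X : Matrix (Fin N) (Fin d) ℝ)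
    (e : ℕ → ℝ)
    (he : ∀ i, e i = norm2inf (hiddenStates σ WQ WK WV WA1 WA2 X i -
        ltHiddenStates σ WQ WK WV WA1 WA2 I M X i))
    (s : ℕ → ℝ)
    (hs : ∀ l, s l = ⨆ i : Fin N, (1 / (H : ℝ)) * ∑ h, ∑ j ∈ M i,
        causalAttn (matLN (hiddenStates σ WQ WK WV WA1 WA2 X (l - 1)))
          (WQ l h) (WK l h) i j) :
    ∀ i, 1 ≤ i → i ≤ L →
      e i ≤ e (i - 1)
        + (H * B + L_lip * B ^ 2 + 4 * H * B ^ 3) *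
            min 2 ((1 + H * B * (1 + 4 * B ^ 2)) * e (i - 1))
        + 2 * H * (B + L_lip * B ^ 3) * (if i ∈ I then s i else 0) := by
  intro i hi hiL
  obtain ⟨i, rfl⟩ : ∃ k, i = k + 1 := ⟨i - 1, by omega⟩
  rw [Nat.add_sub_cancel]
  set U := hiddenStates σ WQ WK WV WA1 WA2 X i
  set V := ltHiddenStates σ WQ WK WV WA1 WA2 I M X i
  have hei : e i = norm2inf (U - V) := he i
  have he0 : 0 ≤ e i := hei ▸ norm2inf_nonneg _
  have hrow : ∀ k, l2norm (U k - V k) ≤ e i := fun k => by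
    rw [hei]; exact l2norm_row_le_norm2inf (U - V) k
  have hLN : ∀ k, l2norm (matLN U k - matLN V k) ≤ min 2 (e i) := fun k =>
    (l2norm_LN_sub_LN_le_min (U k) (V k)).trans (min_le_min le_rfl (hrow k))
  have hmass : ∀ k, 0 ≤ ∑ h, ∑ j ∈ M k,
      causalAttn (matLN U) (WQ (i + 1) h) (WK (i + 1) h) k j := fun k =>
    Finset.sum_nonneg fun h _ => Finset.sum_nonneg fun j _ => by
      rw [causalAttn_eq_softmaxOn]; exact softmaxOn_nonneg _ _ _
  have hs' : s (i + 1) = ⨆ k : Fin N, (1 / (H : ℝ)) * ∑ h, ∑ j ∈ M k,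
      causalAttn (matLN U) (WQ (i + 1) h) (WK (i + 1) h) k j := hs (i + 1)
  have hs0 : 0 ≤ s (i + 1) := by
    rw [hs']
    exact Real.iSup_nonneg fun k => mul_nonneg (by positivity) (hmass k)
  have hmass_le : ∀ k, ∑ h, ∑ j ∈ M k,
      causalAttn (matLN U) (WQ (i + 1) h) (WK (i + 1) h) k j ≤ H * s (i + 1) := fun k => by
    rcases Nat.eq_zero_or_pos H with rfl | hH
    · simp
    · have hH' : (0 : ℝ) < H := by exact_mod_cast hH
      have := le_ciSup (f := fun k : Fin N => (1 / (H : ℝ)) * ∑ h, ∑ j ∈ M k,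
        causalAttn (matLN U) (WQ (i + 1) h) (WK (i + 1) h) k j) (Set.finite_range _).bddAbove k
      rw [← hs'] at this
      rwa [one_div, inv_mul_le_iff₀ hH'] at this
  set r : ℝ := 2 * B * (H * if i + 1 ∈ I then s (i + 1) else 0) with hr
  have hr0 : 0 ≤ r := by
    rw [hr]
    split_ifs <;> positivity
  have hattn : ∀ k, l2norm (mha (matLN U) (WQ (i + 1)) (WK (i + 1)) (WV (i + 1)) k -
      (if i + 1 ∈ I then lazyMha (matLN V) (WQ (i + 1)) (WK (i + 1)) (WV (i + 1)) M
       else mha (matLN V) (WQ (i + 1)) (WK (i + 1)) (WV (i + 1))) k) ≤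
      H * B * (1 + 4 * B ^ 2) * min 2 (e i) + r := fun k => by
    rw [hr]
    split_ifs with h
    · refine (l2norm_mha_row_sub_lazyMha_le (hWQ _ hi hiL) (hWK _ hi hiL) (hWV _ hi hiL)
        (l2norm_matLN_row_le_one U) (l2norm_matLN_row_le_one V) hLN k).trans ?_
      have := mul_le_mul_of_nonneg_left (hmass_le k) (by positivity : 0 ≤ 2 * B)
      linarith
    · have := l2norm_mha_row_sub_le (hWQ _ hi hiL) (hWK _ hi hiL) (hWV _ hi hiL)
        (l2norm_matLN_row_le_one U) (l2norm_matLN_row_le_one V) hLN k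
      linarith
  have hlayer := fun k => l2norm_layer_row_sub_le hL_lip.le hσ (hWA1 _ hi hiL) (hWA2 _ hi hiL)
    (by positivity : 0 ≤ H * B * (1 + 4 * B ^ 2)) he0 hr0 k (hrow k) (hattn k)
  have hbound : e i + (H * B * (1 + 4 * B ^ 2) + L_lip * B ^ 2) *
        min 2 ((1 + H * B * (1 + 4 * B ^ 2)) * e i) + (1 + L_lip * B ^ 2) * r =
      e i + (H * B + L_lip * B ^ 2 + 4 * H * B ^ 3) *
        min 2 ((1 + H * B * (1 + 4 * B ^ 2)) * e i)
        + 2 * H * (B + L_lip * B ^ 3) * (if i + 1 ∈ I then s (i + 1) else 0) := by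
    rw [hr]; ring
  rw [← hbound, he (i + 1)]
  exact Real.iSup_le hlayer (by positivity)
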